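/- For every odd integer k ≥ 1, there exists a k-uniform cubefree binary morphism. -/

import Mathlib

/-- The Thue–Morse morphism θ (0 ↦ 01, 1 ↦ 10), with 0 = `false`, 1 = `true`,
applied letterwise to a word. -/
def tmMap (w : List Bool) : List Bool :=
  w.flatMap (fun b => if b then [true, false] else [false, true])

/-- A word is cubefree if it contains no non-empty factor of the form `x ++ x ++ x`. -/
def Cubefree (w : List Bool) : Prop :=
  ∀ x : List Bool, x ≠ [] → ¬ (x ++ x ++ x) <:+: w

/-- `w` is a factor of the Thue–Morse word `t = θ^ω(0)`: since the words `θ^m(0)`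
are prefixes of `t` whose lengths tend to infinity, this holds iff `w` is an
infix of `θ^m(0)` for some `m`. -/
def FactorTM (w : List Bool) : Prop :=
  ∃ m : ℕ, w <:+: tmMap^[m] [false]

/-- The binary morphism determined by `h : Bool → List Bool` is cubefree. -/
def CubefreeMorphism (h : Bool → List Bool) : Prop :=
  ∀ w : List Bool, Cubefree w → Cubefree (w.flatMap h)

/-- The length-`N` prefix of `f` contains no cube. -/
def CubefreeUpTo (f : ℕ → Bool) (N : ℕ) : Prop :=
  ∀ i < N, ∀ p < N, 0 < p → i + 3 * p ≤ N → ∃ j < 2 * p, f (i + j) ≠ f (i + j + p)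

instance (f : ℕ → Bool) (N : ℕ) : Decidable (CubefreeUpTo f N) := by
  unfold CubefreeUpTo; infer_instance

theorem CubefreeUpTo.not_cube {f : ℕ → Bool} {N i p : ℕ} (hf : CubefreeUpTo f N) (hp : 0 < p)
    (hN : i + 3 * p ≤ N) (h : ∀ j < 2 * p, f (i + j) = f (i + j + p)) : False := by
  obtain ⟨j, hj, hne⟩ := hf i (by omega) p (by omega) hp hN
  exact hne (h j hj)

theorem CubefreeUpTo.factor {f : ℕ → Bool} {N : ℕ} (hf : CubefreeUpTo f N) (a : ℕ) {N' : ℕ}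
    (hN : a + N' ≤ N) : CubefreeUpTo (fun n => f (n + a)) N' := by
  intro i _ p _ hp hle
  by_contra! hcon
  refine hf.not_cube (i := i + a) hp (by omega) fun j hj => ?_
  have := hcon j hj
  rwa [show i + j + a = i + a + j by omega, show i + j + p + a = i + a + j + p by omega] at this

/-- Cubefreeness of a list in terms of its letters. -/
theorem cubefree_iff_cubefreeUpTo (w : List Bool) :
    Cubefree w ↔ CubefreeUpTo (fun n => w.getD n false) w.length := by
  constructor
  · intro hw i _ p _ hp hle
    by_contra! hcon
    have hx : ((w.drop i).take p).length = p := by simp; omega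
    refine hw ((w.drop i).take p) (by intro h; simp [h] at hx; omega) ?_
    have heq : (w.drop i).take p ++ (w.drop i).take p ++ (w.drop i).take p
        = (w.drop i).take (3 * p) := by
      apply List.ext_getElem
      · simp; omega
      · intro n h1 h2
        have hn : n < 3 * p := by simp at h2; omega
        have key : ∀ j < 2 * p, w[i + j]? = w[i + j + p]? := by
          intro j hj
          have := hcon j hj
          simp only [List.getD_eq_getElem?_getD] at this
          rw [List.getElem?_eq_getElem (by omega), List.getElem?_eq_getElem (by omega)] at this ⊢
          simpa using this
        rw [← Option.some_inj, ← List.getElem?_eq_getElem, ← List.getElem?_eq_getElem]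
        simp only [List.getElem?_append, List.length_append, hx, List.getElem?_take,
          List.getElem?_drop]
        split_ifs with c1 c2 c3 <;> try omega
        · rfl
        · rw [key _ (by omega)]; congr 1; omega
        · rw [key (n - (p + p)) (by omega), Nat.add_assoc, key (n - (p + p) + p) (by omega)]
          congr 1; omega
    rw [heq]
    exact ⟨w.take i, (w.drop i).drop (3 * p), by simp only [List.append_assoc, List.take_append_drop]⟩
  · rintro hf x hx ⟨s, t, rfl⟩
    have hp : 0 < x.length := List.length_pos_iff.mpr hx
    refine hf.not_cube (i := s.length) hp (by simp; omega) fun j hj => ?_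
    simp only [List.getD_eq_getElem?_getD, List.append_assoc]
    rw [Nat.add_assoc, List.getElem?_append_right (Nat.le_add_right _ _),
      List.getElem?_append_right (Nat.le_add_right _ _), Nat.add_sub_cancel_left,
      Nat.add_sub_cancel_left]
    rw [List.getElem?_append_right (l₁ := x) (i := j + x.length) (by omega), Nat.add_sub_cancel]
    rcases lt_or_ge j x.length with h | h
    · rw [List.getElem?_append_left h, List.getElem?_append_left h]
    · rw [List.getElem?_append_right h, List.getElem?_append_right h,
        List.getElem?_append_left (by omega), List.getElem?_append_left (by omega)]

/-- The image of an infinite word under the `k`-uniform morphism whose blocks are the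
length-`k` prefixes of `g false` and `g true`. -/
def uniformImage (g : Bool → ℕ → Bool) (k : ℕ) (f : ℕ → Bool) (i : ℕ) : Bool :=
  g (f (i / k)) (i % k)

theorem uniformImage_mul_add (g : Bool → ℕ → Bool) {k : ℕ} (f : ℕ → Bool) (b : ℕ) {t : ℕ}
    (ht : t < k) : uniformImage g k f (k * b + t) = g (f b) t := by
  have hk : 0 < k := by omega
  rw [uniformImage, Nat.mul_add_div hk, Nat.mul_add_mod, Nat.div_eq_of_lt ht,
    Nat.mod_eq_of_lt ht, Nat.add_zero]

theorem getD_flatMap_range (g : Bool → ℕ → Bool) {k : ℕ} (hk : 0 < k) (w : List Bool) :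
    ∀ n < k * w.length, (w.flatMap fun a => (List.range k).map (g a)).getD n false
      = uniformImage g k (fun m => w.getD m false) n := by
  induction w with
  | nil => simp
  | cons a w ih =>
    intro n hn
    simp only [List.length_cons, Nat.mul_succ] at hn
    simp only [List.flatMap_cons, uniformImage]
    rcases lt_or_ge n k with h | h
    · rw [List.getD_append _ _ _ _ (by simpa using h), Nat.div_eq_of_lt h, Nat.mod_eq_of_lt h]
      simp [List.getD_eq_getElem?_getD, h]
    · rw [List.getD_append_right _ _ _ _ (by simpa using h)]
      simp only [List.length_map, List.length_range]
      rw [ih _ (by omega), uniformImage, Nat.div_eq_sub_div hk h, List.getD_cons_succ,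
        Nat.mod_eq_sub_mod h]

/-- A cube in the image whose period is a multiple of the block length comes from a cube. -/
theorem not_cube_of_dvd {g : Bool → ℕ → Bool} {k : ℕ} (hne : ∃ t < k, g false t ≠ g true t)
    {f : ℕ → Bool} {N : ℕ} (hf : CubefreeUpTo f N) {i q : ℕ} (hq : 0 < q)
    (hN : i + 3 * (k * q) ≤ k * N)
    (h : ∀ j < 2 * (k * q), uniformImage g k f (i + j) = uniformImage g k f (i + j + k * q)) :
    False := by
  obtain ⟨t₀, ht₀, hne⟩ := hne
  have hk : 0 < k := by omega
  obtain ⟨b, r, hr, rfl⟩ : ∃ b r, r < k ∧ i = k * b + r :=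
    ⟨i / k, i % k, Nat.mod_lt _ hk, (Nat.div_add_mod i k).symm⟩
  have agree : ∀ j t, t < k → r ≤ k * j + t → k * j + t < r + 2 * (k * q) →
      g (f (b + j)) t = g (f (b + j + q)) t := by
    intro j t ht h1 h2
    have := h (k * j + t - r) (by omega)
    rw [show k * b + r + (k * j + t - r) = k * (b + j) + t by rw [mul_add]; omega,
      show k * (b + j) + t + k * q = k * (b + j + q) + t by ring,
      uniformImage_mul_add _ _ _ ht, uniformImage_mul_add _ _ _ ht] at this
    exact this
  have inj : ∀ x y : Bool, (∀ t < k, g x t = g y t) → x = y := by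
    intro x y hxy
    have := hxy t₀ ht₀
    cases x <;> cases y <;> simp_all
  have full : ∀ j, 1 ≤ j → j < 2 * q → f (b + j) = f (b + j + q) := by
    intro j h1 h2
    refine inj _ _ fun t ht => agree j t ht ?_ ?_
    · nlinarith
    · have : k * (j + 1) ≤ k * (2 * q) := Nat.mul_le_mul_left k (by omega)
      nlinarith
  have hbN : b + 3 * q ≤ N := by
    refine Nat.le_of_mul_le_mul_left ?_ hk
    rw [mul_add]; linarith
  by_cases h0 : f b = f (b + q)
  · refine hf.not_cube hq hbN fun j hj => ?_
    rcases Nat.eq_zero_or_pos j with rfl | hj0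
    · simpa using h0
    · exact full j hj0 hj
  · have hswap : ∀ x y : Bool, x ≠ y → g x t₀ = g y t₀ → False := by
      intro x y hxy he
      cases x <;> cases y <;> simp_all
    have hkq : k ≤ k * q := Nat.le_mul_of_pos_right k hq
    rcases le_or_gt r t₀ with hrt | hrt
    · exact hswap _ _ h0 (by simpa using agree 0 t₀ ht₀ (by omega) (by omega))
    · have hbN' : b + 1 + 3 * q ≤ N := by
        have : k * (b + 3 * q) < k * N := by rw [mul_add]; linarith
        have := Nat.lt_of_mul_lt_mul_left this
        omega
      refine hf.not_cube hq hbN' fun j hj => ?_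
      rw [show b + 1 + j = b + (j + 1) by omega]
      rcases lt_or_ge (j + 1) (2 * q) with hj' | hj'
      · exact full _ (by omega) hj'
      · obtain hjq : j + 1 = 2 * q := by omega
        rw [hjq]
        by_contra hc
        exact hswap _ _ hc (agree (2 * q) t₀ ht₀ (by nlinarith) (by nlinarith))

/-- A uniform morphism with distinct blocks is cubefree if its factors of length `s` determine
their position modulo the block length and its images have no cube shorter than `3 * s / 2`. -/
theorem cubefreeMorphism_of_sync {g : Bool → ℕ → Bool} {k : ℕ}
    (hne : ∃ t < k, g false t ≠ g true t) (s : ℕ)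
    (sync : ∀ f i j, (∀ t < s, uniformImage g k f (i + t) = uniformImage g k f (j + t)) →
      i % k = j % k)
    (short : ∀ f i p, 0 < p → 2 * p < s →
      ¬ ∀ j < 2 * p, uniformImage g k f (i + j) = uniformImage g k f (i + j + p)) :
    CubefreeMorphism fun a => (List.range k).map (g a) := by
  have hk : 0 < k := by obtain ⟨t, ht, -⟩ := hne; omega
  intro w hw
  rw [cubefree_iff_cubefreeUpTo] at hw ⊢
  have hlen : (w.flatMap fun a => (List.range k).map (g a)).length = k * w.length := by
    simp [List.length_flatMap, mul_comm]
  rw [hlen]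
  intro i _ p _ hp hle
  by_contra! hcon
  have hper : ∀ j < 2 * p, uniformImage g k (fun m => w.getD m false) (i + j)
      = uniformImage g k (fun m => w.getD m false) (i + j + p) := by
    intro j hj
    rw [← getD_flatMap_range g hk w _ (by omega), ← getD_flatMap_range g hk w _ (by omega)]
    exact hcon j hj
  rcases lt_or_ge (2 * p) s with hs | hs
  · exact short _ i p hp hs hper
  · have hmod := sync (fun m => w.getD m false) i (i + p) fun t ht => by
      rw [hper t (by omega)]; congr 1; omega
    obtain ⟨q, rfl⟩ : k ∣ p := by
      have := (Nat.modEq_iff_dvd' (Nat.le_add_right i p)).mp hmod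
      simpa using this
    exact not_cube_of_dvd hne hw (Nat.pos_of_mul_pos_left hp) hle hper

/-- The Thue–Morse morphism on infinite words. -/
def thueMorse (f : ℕ → Bool) (n : ℕ) : Bool := xor (f (n / 2)) (n % 2 == 1)

theorem thueMorse_two_mul (f : ℕ → Bool) (n : ℕ) : thueMorse f (2 * n) = f n := by
  simp [thueMorse]

theorem thueMorse_two_mul_add_one (f : ℕ → Bool) (n : ℕ) :
    thueMorse f (2 * n + 1) = !f n := by
  have h : (2 * n + 1) / 2 = n := by omega
  simp [thueMorse, h]

theorem thueMorse_even_ne_succ (f : ℕ → Bool) {n : ℕ} (hn : n % 2 = 0) :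
    thueMorse f n ≠ thueMorse f (n + 1) := by
  obtain ⟨m, rfl⟩ : ∃ m, n = 2 * m := ⟨n / 2, by omega⟩
  rw [thueMorse_two_mul, thueMorse_two_mul_add_one]
  cases f m <;> simp

/-- A Thue–Morse image of a cubefree word followed by a doubled letter is cubefree, provided that
this letter differs from the last letter of the image. -/
theorem CubefreeUpTo.thueMorse_append {f g : ℕ → Bool} {m : ℕ} (hf : CubefreeUpTo f m)
    (hg : ∀ n < 2 * m, g n = thueMorse f n) (hlast : 0 < m → g (2 * m - 1) ≠ g (2 * m))
    (hdouble : g (2 * m) = g (2 * m + 1)) : CubefreeUpTo g (2 * m + 2) := by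
  intro i _ p _ hp hle
  by_contra! hcon
  have pair : ∀ n, n % 2 = 0 → n < 2 * m → g n ≠ g (n + 1) := by
    intro n hn hm
    rw [hg n hm, hg (n + 1) (by omega)]
    exact thueMorse_even_ne_succ f hn
  rcases Nat.even_or_odd' p with ⟨q, rfl | rfl⟩
  · rcases Nat.lt_or_ge (2 * m + 1) (i + 3 * (2 * q)) with hi | hi
    · have e1 := hcon (2 * (2 * q) - 2) (by omega)
      have e2 := hcon (2 * (2 * q) - 1) (by omega)
      rw [show i + (2 * (2 * q) - 2) + 2 * q = 2 * m by omega] at e1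
      rw [show i + (2 * (2 * q) - 1) + 2 * q = 2 * m + 1 by omega,
        show i + (2 * (2 * q) - 1) = i + (2 * (2 * q) - 2) + 1 by omega] at e2
      exact pair (i + (2 * (2 * q) - 2)) (by omega) (by omega) (by rw [e1, e2, hdouble])
    · refine hf.not_cube (i := i / 2) (p := q) (by omega) (by omega) fun j hj => ?_
      have := hcon (2 * j) (by omega)
      rw [hg (i + 2 * j) (by omega), hg (i + 2 * j + 2 * q) (by omega), thueMorse, thueMorse,
        show (i + 2 * j + 2 * q) % 2 = i % 2 by omega, show (i + 2 * j) % 2 = i % 2 by omega,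
        show (i + 2 * j + 2 * q) / 2 = i / 2 + j + q by omega,
        show (i + 2 * j) / 2 = i / 2 + j by omega] at this
      simpa using this
  · have step : ∀ j < 2 * q + 1, g (i + j + 1) = !g (i + j) := by
      intro j hj
      suffices g (i + j) ≠ g (i + j + 1) by
        revert this; cases g (i + j) <;> cases g (i + j + 1) <;> simp
      rcases Nat.mod_two_eq_zero_or_one (i + j) with h | h
      · exact pair _ h (by omega)
      · have e1 := hcon j (by omega)
        have e2 := hcon (j + 1) (by omega)
        rw [show i + (j + 1) + (2 * q + 1) = i + j + (2 * q + 1) + 1 by omega,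
          ← Nat.add_assoc] at e2
        rcases lt_or_ge (i + j + (2 * q + 1)) (2 * m) with h' | h'
        · rw [e1, e2]
          exact pair _ (by omega) h'
        · have hl := hlast (by omega)
          obtain rfl : q = 0 := by omega
          obtain rfl : j = 0 := by omega
          rwa [show 2 * m - 1 = i + 0 by omega, show 2 * m = i + 0 + 1 by omega] at hl
    have alt : ∀ j ≤ 2 * q + 1, g (i + j) = xor (g i) (j % 2 == 1) := by
      intro j
      induction j with
      | zero => simp
      | succ j ih =>
        intro hj
        rw [← Nat.add_assoc, step j (by omega), ih (by omega)]
        rcases Nat.mod_two_eq_zero_or_one j with h | h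
        · simp [h, show (j + 1) % 2 = 1 by omega]
        · simp [h, show (j + 1) % 2 = 0 by omega]
    have h0 := hcon 0 (by omega)
    rw [Nat.add_zero, alt _ le_rfl, show (2 * q + 1) % 2 = 1 by omega] at h0
    simp at h0

theorem CubefreeUpTo.thueMorse {f : ℕ → Bool} {m : ℕ} (hf : CubefreeUpTo f m) :
    CubefreeUpTo (thueMorse f) (2 * m) := by
  have h : CubefreeUpTo (fun n => if n < 2 * m then _root_.thueMorse f n
      else !_root_.thueMorse f (2 * m - 1)) (2 * m + 2) := by
    refine hf.thueMorse_append (fun n hn => by simp [hn]) (fun hm => ?_) (by simp)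
    simp [hm]
  intro i _ p _ hp hle
  by_contra! hcon
  refine h.not_cube (i := i) hp (by omega) fun j hj => ?_
  simpa [show i + j < 2 * m by omega, show i + j + p < 2 * m by omega] using hcon j hj

/-- The word `01010` occurs in `f` at position `i`. -/
def MarkerAt (f : ℕ → Bool) (i : ℕ) : Prop :=
  f i = false ∧ f (i + 1) = true ∧ f (i + 2) = false ∧ f (i + 3) = true ∧ f (i + 4) = false

theorem CubefreeUpTo.not_markerAt_thueMorse {f : ℕ → Bool} {m i : ℕ} (hf : CubefreeUpTo f m)
    (hi : i + 5 ≤ 2 * m) : ¬ MarkerAt (_root_.thueMorse f) i := by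
  rintro ⟨h0, h1, h2, h3, h4⟩
  have key : f (i / 2) = f (i / 2 + 1) ∧ f (i / 2 + 1) = f (i / 2 + 2) := by
    rcases Nat.even_or_odd' i with ⟨c, rfl | rfl⟩
    · rw [show 2 * c + 2 = 2 * (c + 1) by ring, thueMorse_two_mul] at h2
      rw [show 2 * c + 4 = 2 * (c + 2) by ring, thueMorse_two_mul] at h4
      rw [thueMorse_two_mul] at h0
      simp [show 2 * c / 2 = c by omega, h0, h2, h4]
    · rw [show 2 * c + 1 + 1 = 2 * (c + 1) by ring, thueMorse_two_mul] at h1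
      rw [show 2 * c + 1 + 3 = 2 * (c + 2) by ring, thueMorse_two_mul] at h3
      rw [thueMorse_two_mul_add_one] at h0
      simp [show (2 * c + 1) / 2 = c by omega, h1, h3] at h0 ⊢
      exact h0
  refine hf.not_cube (i := i / 2) (p := 1) one_pos (by omega) fun j hj => ?_
  interval_cases j
  · exact key.1
  · exact key.2

/-- `x` has a cubefree prefix of length `l + 3` of the form `110…100`. -/
structure Core (l : ℕ) (x : ℕ → Bool) : Prop where
  cubefree : CubefreeUpTo x (l + 3)
  zero : x 0 = true
  one : x 1 = true
  two : x 2 = false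
  ante : x l = true
  penult : x (l + 1) = false
  last : x (l + 2) = false

/-- The block `0 θ(x)`. -/
def markedBlock (x : Bool → ℕ → Bool) (a : Bool) : ℕ → Bool
  | 0 => false
  | t + 1 => thueMorse (x a) t

section MarkedBlock

variable {l : ℕ} {x : Bool → ℕ → Bool}

theorem Core.thueMorse_head {y : ℕ → Bool} (h : Core l y) :
    thueMorse y 0 = true ∧ thueMorse y 1 = false ∧ thueMorse y 2 = true ∧
      thueMorse y 3 = false ∧ thueMorse y 4 = false := by
  simp [thueMorse, h.zero, h.one, h.two]

theorem Core.thueMorse_tail {y : ℕ → Bool} (h : Core l y) :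
    thueMorse y (2 * l + 1) = false ∧ thueMorse y (2 * l + 2) = false ∧
      thueMorse y (2 * l + 3) = true ∧ thueMorse y (2 * l + 4) = false ∧
        thueMorse y (2 * l + 5) = true := by
  refine ⟨?_, ?_, ?_, ?_, ?_⟩
  · rw [thueMorse_two_mul_add_one, h.ante]; rfl
  · rw [show 2 * l + 2 = 2 * (l + 1) by ring, thueMorse_two_mul, h.penult]
  · rw [show 2 * l + 3 = 2 * (l + 1) + 1 by ring, thueMorse_two_mul_add_one, h.penult]; rfl
  · rw [show 2 * l + 4 = 2 * (l + 2) by ring, thueMorse_two_mul, h.last]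
  · rw [show 2 * l + 5 = 2 * (l + 2) + 1 by ring, thueMorse_two_mul_add_one, h.last]; rfl

theorem uniformImage_markedBlock_mul_add (hl : 3 ≤ l) (hx : ∀ a, Core l (x a)) (f : ℕ → Bool)
    (b : ℕ) {t : ℕ} (ht : t < 2 * l + 6) :
    uniformImage (markedBlock x) (2 * l + 3) f ((2 * l + 3) * b + (t + 1))
      = thueMorse (x (f b)) t := by
  rcases lt_or_ge (t + 1) (2 * l + 3) with h | h
  · rw [uniformImage_mul_add _ _ _ h]; rfl
  · obtain ⟨u, rfl⟩ : ∃ u, t = 2 * l + 2 + u := ⟨t - (2 * l + 2), by omega⟩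
    rw [show (2 * l + 3) * b + (2 * l + 2 + u + 1) = (2 * l + 3) * (b + 1) + u by ring,
      uniformImage_mul_add _ _ _ (by omega)]
    obtain ⟨-, s2, s3, s4, s5⟩ := (hx (f b)).thueMorse_tail
    obtain ⟨p0, p1, p2, -, -⟩ := (hx (f (b + 1))).thueMorse_head
    have hu : u < 4 := by omega
    interval_cases u
    · exact s2.symm
    · exact p0.trans s3.symm
    · exact p1.trans s4.symm
    · exact p2.trans s5.symm

theorem markerAt_block_start (hl : 3 ≤ l) (hx : ∀ a, Core l (x a)) (f : ℕ → Bool) (b : ℕ) :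
    MarkerAt (uniformImage (markedBlock x) (2 * l + 3) f) ((2 * l + 3) * b) ∧
      uniformImage (markedBlock x) (2 * l + 3) f ((2 * l + 3) * b + 5) = false := by
  obtain ⟨p0, p1, p2, p3, p4⟩ := (hx (f b)).thueMorse_head
  refine ⟨⟨?_, ?_, ?_, ?_, ?_⟩, ?_⟩
  · exact uniformImage_mul_add _ f b (t := 0) (by omega)
  · rw [← p0]; exact uniformImage_markedBlock_mul_add hl hx f b (by omega)
  · rw [← p1]; exact uniformImage_markedBlock_mul_add hl hx f b (by omega)
  · rw [← p2]; exact uniformImage_markedBlock_mul_add hl hx f b (by omega)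
  · rw [← p3]; exact uniformImage_markedBlock_mul_add hl hx f b (by omega)
  · rw [← p4]; exact uniformImage_markedBlock_mul_add hl hx f b (by omega)

theorem uniformImage_block_end (hl : 3 ≤ l) (hx : ∀ a, Core l (x a)) (f : ℕ → Bool) (b : ℕ) :
    uniformImage (markedBlock x) (2 * l + 3) f ((2 * l + 3) * b + (2 * l + 2)) = false := by
  rw [← (hx (f b)).thueMorse_tail.1]
  exact uniformImage_markedBlock_mul_add hl hx f b (by omega)

theorem dvd_of_markerAt (hl : 3 ≤ l) (hx : ∀ a, Core l (x a)) {f : ℕ → Bool} {c : ℕ}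
    (hc : MarkerAt (uniformImage (markedBlock x) (2 * l + 3) f) c) : (2 * l + 3) ∣ c := by
  by_contra hd
  have hlt : c % (2 * l + 3) < 2 * l + 3 := Nat.mod_lt _ (by omega)
  have hpos : c % (2 * l + 3) ≠ 0 := fun h => hd (Nat.dvd_of_mod_eq_zero h)
  obtain ⟨t, ht⟩ := Nat.exists_eq_succ_of_ne_zero hpos
  have hdiv := Nat.div_add_mod c (2 * l + 3)
  rw [ht] at hlt hdiv
  have tr : ∀ u < 5, uniformImage (markedBlock x) (2 * l + 3) f (c + u)
      = thueMorse (x (f (c / (2 * l + 3)))) (t + u) := by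
    intro u hu
    rw [← uniformImage_markedBlock_mul_add hl hx f _ (by omega)]
    congr 1; omega
  refine (hx (f (c / (2 * l + 3)))).cubefree.not_markerAt_thueMorse (i := t) (by omega) ?_
  obtain ⟨h0, h1, h2, h3, h4⟩ := hc
  exact ⟨(tr 0 (by omega)).symm.trans h0, (tr 1 (by omega)).symm.trans h1,
    (tr 2 (by omega)).symm.trans h2, (tr 3 (by omega)).symm.trans h3,
    (tr 4 (by omega)).symm.trans h4⟩

theorem MarkerAt.congr {f f' : ℕ → Bool} {i i' : ℕ} (h : MarkerAt f i)
    (heq : ∀ v < 5, f' (i' + v) = f (i + v)) : MarkerAt f' i' := by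
  obtain ⟨h0, h1, h2, h3, h4⟩ := h
  exact ⟨(heq 0 (by omega)).trans h0, (heq 1 (by omega)).trans h1, (heq 2 (by omega)).trans h2,
    (heq 3 (by omega)).trans h3, (heq 4 (by omega)).trans h4⟩

theorem markedBlock_sync (hl : 3 ≤ l) (hx : ∀ a, Core l (x a)) (f : ℕ → Bool) (i j : ℕ)
    (hij : ∀ t < 2 * l + 7, uniformImage (markedBlock x) (2 * l + 3) f (i + t)
      = uniformImage (markedBlock x) (2 * l + 3) f (j + t)) :
    i % (2 * l + 3) = j % (2 * l + 3) := by
  have hi := Nat.div_add_mod (i + (2 * l + 2)) (2 * l + 3)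
  have hlt : (i + (2 * l + 2)) % (2 * l + 3) < 2 * l + 3 := Nat.mod_lt _ (by omega)
  set b := (i + (2 * l + 2)) / (2 * l + 3)
  obtain ⟨u, hu⟩ : ∃ u, (2 * l + 3) * b = i + u := ⟨(2 * l + 3) * b - i, by omega⟩
  have hmark := (markerAt_block_start hl hx f b).1
  rw [hu] at hmark
  have hdvd := dvd_of_markerAt hl hx (hmark.congr (i' := j + u) fun v hv => by
    rw [Nat.add_assoc, Nat.add_assoc, hij (u + v) (by omega)])
  have hmod : i + u ≡ j + u [MOD 2 * l + 3] := by
    rw [← hu]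
    exact (Nat.modEq_zero_iff_dvd.mpr (dvd_mul_right _ _)).trans
      (Nat.modEq_zero_iff_dvd.mpr hdvd).symm
  exact Nat.ModEq.add_right_cancel' u hmod

theorem markedBlock_not_short_cube (hl : 3 ≤ l) (hx : ∀ a, Core l (x a)) (f : ℕ → Bool)
    (i p : ℕ) (hp : 0 < p) (hps : 2 * p < 2 * l + 7) :
    ¬ ∀ j < 2 * p, uniformImage (markedBlock x) (2 * l + 3) f (i + j)
      = uniformImage (markedBlock x) (2 * l + 3) f (i + j + p) := by
  intro hper
  have hi := Nat.div_add_mod i (2 * l + 3)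
  have hlt : i % (2 * l + 3) < 2 * l + 3 := Nat.mod_lt _ (by omega)
  set b := i / (2 * l + 3)
  set r := i % (2 * l + 3)
  have nodvd : ¬ (2 * l + 3) ∣ p := fun h => by
    have := Nat.le_of_dvd hp h
    omega
  by_cases hin : 0 < r ∧ r + 3 * p ≤ 2 * l + 7
  · obtain ⟨hr, hr'⟩ := hin
    refine (hx (f b)).cubefree.thueMorse.not_cube (i := r - 1) hp (by omega) fun j hj => ?_
    have := hper j hj
    rw [show i + j = (2 * l + 3) * b + (r - 1 + j + 1) by omega,
      show (2 * l + 3) * b + (r - 1 + j + 1) + p = (2 * l + 3) * b + (r - 1 + j + p + 1) by omega,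
      uniformImage_markedBlock_mul_add hl hx f b (by omega),
      uniformImage_markedBlock_mul_add hl hx f b (by omega)] at this
    exact this
  obtain ⟨c, u, hcu, hc⟩ :
      ∃ c u, (2 * l + 3) * c = i + u ∧ (u + 5 ≤ 3 * p ∨ p = 1 ∧ u = 0) := by
    rcases Nat.eq_zero_or_pos r with hr | hr
    · exact ⟨b, 0, by omega, by omega⟩
    · exact ⟨b + 1, 2 * l + 3 - r, by rw [mul_add]; omega, by omega⟩
  obtain ⟨hmark, h5⟩ := markerAt_block_start hl hx f c
  have hend : u = 1 → uniformImage (markedBlock x) (2 * l + 3) f i = false := by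
    rintro rfl
    obtain ⟨c', rfl⟩ : ∃ c', c = c' + 1 := by
      refine Nat.exists_eq_succ_of_ne_zero ?_
      rintro rfl
      omega
    rw [← uniformImage_block_end hl hx f c']
    rw [mul_add] at hcu
    congr 1; omega
  have hdc : (2 * l + 3) ∣ i + u := ⟨c, hcu.symm⟩
  rw [hcu] at hmark h5
  rcases lt_or_ge (u + 4) (2 * p) with hR | hR
  · have hd := dvd_of_markerAt hl hx (hmark.congr (i' := i + u + p) fun v hv => by
      rw [Nat.add_assoc i u v, hper (u + v) (by omega)]
      congr 1; omega)
    exact nodvd ((Nat.dvd_add_right hdc).mp hd)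
  rcases le_or_gt p u with hL | hL
  · have hd := dvd_of_markerAt hl hx (hmark.congr (i' := i + (u - p)) fun v hv => by
      rw [Nat.add_assoc i (u - p) v, hper (u - p + v) (by omega)]
      congr 1; omega)
    rw [show i + u = i + (u - p) + p by omega] at hdc
    exact nodvd ((Nat.dvd_add_right hd).mp hdc)
  have hp3 : p ≤ 3 := by omega
  obtain ⟨h0, h1, h2, h3, h4⟩ := hmark
  interval_cases p
  · obtain rfl : u = 0 := by omega
    have := hper 0 (by omega)
    simp_all
  · obtain rfl | rfl : u = 0 ∨ u = 1 := by omega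
    · have := hper 3 (by omega)
      simp_all
    · have := hper 0 (by omega)
      have := hend rfl
      simp_all
  · obtain rfl : u = 2 := by omega
    have := hper 2 (by omega)
    simp_all

theorem cubefreeMorphism_markedBlock (hl : 3 ≤ l) (hx : ∀ a, Core l (x a))
    (hne : ∃ n < l + 3, x false n ≠ x true n) :
    CubefreeMorphism fun a => (List.range (2 * l + 3)).map (markedBlock x a) := by
  refine cubefreeMorphism_of_sync ?_ (2 * l + 7) (markedBlock_sync hl hx)
    (markedBlock_not_short_cube hl hx)
  obtain ⟨n, hn, hne⟩ := hne
  have hn1 : n ≠ l + 1 := by rintro rfl; simp [(hx _).penult] at hne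
  have hn2 : n ≠ l + 2 := by rintro rfl; simp [(hx _).last] at hne
  exact ⟨2 * n + 1, by omega, by simpa [markedBlock, thueMorse_two_mul] using hne⟩

end MarkedBlock

/-- `y` has a cubefree prefix of length `m + 2` of the form `01…10`. -/
structure Seed (m : ℕ) (y : ℕ → Bool) : Prop where
  cubefree : CubefreeUpTo y (m + 2)
  zero : y 0 = false
  one : y 1 = true
  penult : y m = true
  last : y (m + 1) = false

/-- The word `θ(u)00`, where `u` is the length-`n` prefix of `y`. -/
def doubled (n : ℕ) (y : ℕ → Bool) (i : ℕ) : Bool := if i < 2 * n then thueMorse y i else false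

theorem doubled_of_lt {n i : ℕ} (y : ℕ → Bool) (h : i < 2 * n) :
    doubled n y i = thueMorse y i := if_pos h

theorem doubled_of_le {n i : ℕ} (y : ℕ → Bool) (h : 2 * n ≤ i) :
    doubled n y i = false := if_neg (by omega)

namespace Seed

variable {m : ℕ} {y : ℕ → Bool}

theorem cubefree_doubled (h : Seed m y) : CubefreeUpTo (doubled (m + 2) y) (2 * m + 6) := by
  refine h.cubefree.thueMorse_append (fun n hn => doubled_of_lt y hn) (fun _ => ?_) ?_
  · rw [doubled_of_lt y (by omega), doubled_of_le y le_rfl,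
      show 2 * (m + 2) - 1 = 2 * (m + 1) + 1 by omega, thueMorse_two_mul_add_one, h.last]
    simp
  · rw [doubled_of_le y le_rfl, doubled_of_le y (by omega)]

theorem doubled_head (h : Seed m y) : doubled (m + 2) y 0 = false ∧
    doubled (m + 2) y 1 = true ∧ doubled (m + 2) y 2 = true ∧ doubled (m + 2) y 3 = false := by
  refine ⟨?_, ?_, ?_, ?_⟩ <;> rw [doubled_of_lt y (by omega)] <;>
    simp [thueMorse, h.zero, h.one]

theorem doubled_tail (h : Seed m y) : doubled (m + 2) y (2 * m) = true ∧
    doubled (m + 2) y (2 * m + 1) = false ∧ doubled (m + 2) y (2 * m + 2) = false ∧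
      doubled (m + 2) y (2 * m + 3) = true ∧ doubled (m + 2) y (2 * m + 4) = false ∧
        doubled (m + 2) y (2 * m + 5) = false := by
  refine ⟨?_, ?_, ?_, ?_, doubled_of_le y (by omega), doubled_of_le y (by omega)⟩ <;>
    rw [doubled_of_lt y (by omega)]
  · rw [thueMorse_two_mul, h.penult]
  · rw [thueMorse_two_mul_add_one, h.penult]; rfl
  · rw [show 2 * m + 2 = 2 * (m + 1) by ring, thueMorse_two_mul, h.last]
  · rw [show 2 * m + 3 = 2 * (m + 1) + 1 by ring, thueMorse_two_mul_add_one, h.last]; rfl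

theorem seed_even (h : Seed m y) : Seed (2 * m) (doubled (m + 2) y) :=
  ⟨h.cubefree_doubled.factor 0 (by omega), h.doubled_head.1, h.doubled_head.2.1,
    h.doubled_tail.1, h.doubled_tail.2.1⟩

theorem seed_odd (h : Seed m y) : Seed (2 * m + 3) (doubled (m + 2) y) :=
  ⟨h.cubefree_doubled.factor 0 (by omega), h.doubled_head.1, h.doubled_head.2.1,
    h.doubled_tail.2.2.2.1, h.doubled_tail.2.2.2.2.1⟩

/-- The core obtained from `θ(u)` by deleting the first and the last letter. -/
theorem core_odd (h : Seed (m + 1) y) :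
    Core (2 * m + 1) fun n => doubled (m + 3) y (n + 1) :=
  ⟨h.cubefree_doubled.factor 1 (by omega), h.doubled_head.2.1, h.doubled_head.2.2.1,
    h.doubled_head.2.2.2, h.doubled_tail.1, h.doubled_tail.2.1, h.doubled_tail.2.2.1⟩

/-- The core obtained from `θ(u)00` by deleting the first letter. -/
theorem core_even (h : Seed m y) : Core (2 * m + 2) fun n => doubled (m + 2) y (n + 1) :=
  ⟨h.cubefree_doubled.factor 1 (by omega), h.doubled_head.2.1, h.doubled_head.2.2.1,
    h.doubled_head.2.2.2, h.doubled_tail.2.2.2.1, h.doubled_tail.2.2.2.2.1,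
    h.doubled_tail.2.2.2.2.2⟩

end Seed

instance (m : ℕ) (y : ℕ → Bool) : Decidable (Seed m y) :=
  decidable_of_iff (CubefreeUpTo y (m + 2) ∧ y 0 = false ∧ y 1 = true ∧ y m = true ∧
    y (m + 1) = false)
    ⟨fun ⟨a, b, c, d, e⟩ => ⟨a, b, c, d, e⟩, fun ⟨a, b, c, d, e⟩ => ⟨a, b, c, d, e⟩⟩

instance (l : ℕ) (x : ℕ → Bool) : Decidable (Core l x) :=
  decidable_of_iff (CubefreeUpTo x (l + 3) ∧ x 0 = true ∧ x 1 = true ∧ x 2 = false ∧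
    x l = true ∧ x (l + 1) = false ∧ x (l + 2) = false)
    ⟨fun ⟨a, b, c, d, e, f, g⟩ => ⟨a, b, c, d, e, f, g⟩,
      fun ⟨a, b, c, d, e, f, g⟩ => ⟨a, b, c, d, e, f, g⟩⟩

/-- The infinite word whose letters are the binary digits of a number, least significant first. -/
abbrev bitWord (c : ℕ) : ℕ → Bool := c.testBit

/-- Two seeds of the same length differing at an interior position. -/
theorem exists_distinct_seeds (m : ℕ) (hm : 4 ≤ m) :
    ∃ y y' : ℕ → Bool, Seed m y ∧ Seed m y' ∧ ∃ n < m, y n ≠ y' n := by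
  induction m using Nat.strong_induction_on with
  | _ m ih =>
    by_cases hbase : m = 4 ∨ m = 5 ∨ m = 6 ∨ m = 7 ∨ m = 9
    · rcases hbase with rfl | rfl | rfl | rfl | rfl
      · exact ⟨bitWord 18, bitWord 26, by decide +kernel, by decide +kernel, 3,
          by decide, by decide⟩
      · exact ⟨bitWord 50, bitWord 38, by decide +kernel, by decide +kernel, 2,
          by decide, by decide⟩
      · exact ⟨bitWord 82, bitWord 74, by decide +kernel, by decide +kernel, 3,
          by decide, by decide⟩
      · exact ⟨bitWord 210, bitWord 178, by decide +kernel, by decide +kernel, 5,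
          by decide, by decide⟩
      · exact ⟨bitWord 594, bitWord 722, by decide +kernel, by decide +kernel, 7,
          by decide, by decide⟩
    · have double : ∀ {c : ℕ} {y y' : ℕ → Bool} {n : ℕ}, n < c → y n ≠ y' n →
          doubled (c + 2) y (2 * n) ≠ doubled (c + 2) y' (2 * n) := by
        intro c y y' n hn hne
        rwa [doubled_of_lt y (by omega), doubled_of_lt y' (by omega), thueMorse_two_mul,
          thueMorse_two_mul]
      obtain ⟨c, rfl | rfl⟩ : ∃ c, m = 2 * c ∨ m = 2 * c + 3 := by
        rcases Nat.mod_two_eq_zero_or_one m with h | h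
        · exact ⟨m / 2, by omega⟩
        · exact ⟨(m - 3) / 2, by omega⟩
      · obtain ⟨y, y', hy, hy', n, hn, hne⟩ := ih c (by omega) (by omega)
        exact ⟨_, _, hy.seed_even, hy'.seed_even, 2 * n, by omega, double hn hne⟩
      · obtain ⟨y, y', hy, hy', n, hn, hne⟩ := ih c (by omega) (by omega)
        exact ⟨_, _, hy.seed_odd, hy'.seed_odd, 2 * n, by omega, double hn hne⟩

theorem exists_distinct_cores (l : ℕ) (hl : 4 ≤ l) (hl5 : l ≠ 5) :
    ∃ x x' : ℕ → Bool, Core l x ∧ Core l x' ∧ ∃ n < l + 3, x n ≠ x' n := by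
  by_cases hbase : l = 4 ∨ l = 6 ∨ l = 8
  · rcases hbase with rfl | rfl | rfl
    · exact ⟨bitWord 19, bitWord 27, by decide +kernel, by decide +kernel, 3,
        by decide, by decide⟩
    · exact ⟨bitWord 83, bitWord 75, by decide +kernel, by decide +kernel, 3,
        by decide, by decide⟩
    · exact ⟨bitWord 403, bitWord 307, by decide +kernel, by decide +kernel, 5,
        by decide, by decide⟩
  · have double : ∀ {c : ℕ} {y y' : ℕ → Bool} {n : ℕ}, n < c → y n ≠ y' n →
        doubled (c + 2) y (2 * n + 1) ≠ doubled (c + 2) y' (2 * n + 1) := by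
      intro c y y' n hn hne
      rw [doubled_of_lt y (by omega), doubled_of_lt y' (by omega), thueMorse_two_mul_add_one,
        thueMorse_two_mul_add_one]
      simpa using hne
    rcases Nat.even_or_odd' l with ⟨c, rfl | rfl⟩
    · obtain ⟨m, rfl⟩ : ∃ m, c = m + 1 := ⟨c - 1, by omega⟩
      obtain ⟨y, y', hy, hy', n, hn, hne⟩ := exists_distinct_seeds m (by omega)
      exact ⟨_, _, hy.core_even, hy'.core_even, 2 * n, by omega, double hn hne⟩
    · obtain ⟨y, y', hy, hy', n, hn, hne⟩ := exists_distinct_seeds (c + 1) (by omega)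
      exact ⟨_, _, hy.core_odd, hy'.core_odd, 2 * n, by omega, double hn hne⟩

/-- The letter at position `n` of the image of the three-letter word `abc`. -/
def tripleImage (g : Bool → ℕ → Bool) (k : ℕ) (a b c : Bool) (n : ℕ) : Bool :=
  g (if n < k then a else if n < 2 * k then b else c) (n % k)

theorem uniformImage_eq_tripleImage (g : Bool → ℕ → Bool) {k : ℕ} (f : ℕ → Bool) (i t : ℕ)
    (h : i % k + t < 3 * k) : uniformImage g k f (i + t)
      = tripleImage g k (f (i / k)) (f (i / k + 1)) (f (i / k + 2)) (i % k + t) := by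
  obtain ⟨b, r, hb, hr⟩ : ∃ b r, i / k = b ∧ i % k = r := ⟨_, _, rfl, rfl⟩
  have hi : i = k * b + r := by rw [← hb, ← hr, Nat.div_add_mod]
  rw [hb, hr, hi, Nat.add_assoc]
  rw [hr] at h
  generalize r + t = n at h
  have hk : 0 < k := by omega
  rw [uniformImage, Nat.mul_add_div hk, Nat.mul_add_mod, tripleImage]
  split_ifs with h1 h2
  · rw [Nat.div_eq_of_lt h1, Nat.add_zero]
  · rw [Nat.div_eq_of_lt_le (k := 1) (by omega) (by omega)]
  · rw [Nat.div_eq_of_lt_le (k := 2) (by omega) (by omega)]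

/-- A finite test for cubefreeness of a uniform morphism with small synchronization delay. -/
theorem cubefreeMorphism_of_tripleImage {g : Bool → ℕ → Bool} {k : ℕ}
    (hne : ∃ t < k, g false t ≠ g true t) (s : ℕ) (hs : s ≤ k + 1)
    (sync : ∀ a b a' b' : Bool, ∀ r < k, ∀ r' < k,
      (∀ t < s, tripleImage g k a b b (r + t) = tripleImage g k a' b' b' (r' + t)) → r = r')
    (short : ∀ a b c : Bool, ∀ r < k, ∀ p < s, 0 < p → 2 * p < s →
      ¬ ∀ j < 2 * p, tripleImage g k a b c (r + j) = tripleImage g k a b c (r + j + p)) :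
    CubefreeMorphism fun a => (List.range k).map (g a) := by
  have hk : 0 < k := by obtain ⟨t, ht, -⟩ := hne; omega
  have two : ∀ a b c n, n < 2 * k → tripleImage g k a b c n = tripleImage g k a b b n := by
    intro a b c n hn
    simp [tripleImage, hn]
  refine cubefreeMorphism_of_sync hne s (fun f i j hij => ?_) fun f i p hp hps hper => ?_
  · have hi := Nat.mod_lt i hk
    have hj := Nat.mod_lt j hk
    refine sync (f (i / k)) (f (i / k + 1)) (f (j / k)) (f (j / k + 1)) _ hi _ hj fun t ht => ?_
    rw [← two _ _ (f (i / k + 2)) _ (by omega), ← two _ _ (f (j / k + 2)) _ (by omega),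
      ← uniformImage_eq_tripleImage _ _ _ _ (by omega),
      ← uniformImage_eq_tripleImage _ _ _ _ (by omega), hij t ht]
  · have hi := Nat.mod_lt i hk
    refine short (f (i / k)) (f (i / k + 1)) (f (i / k + 2)) _ hi p (by omega) hp hps
      fun j hj => ?_
    rw [Nat.add_assoc, ← uniformImage_eq_tripleImage _ _ _ _ (by omega),
      ← uniformImage_eq_tripleImage _ _ _ _ (by omega), hper j hj, Nat.add_assoc]

theorem cubefreeMorphism_three :
    CubefreeMorphism fun a => (List.range 3).map (bitWord (if a then 6 else 4)) :=
  cubefreeMorphism_of_tripleImage (by decide) 3 (by decide) (by decide +kernel)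
    (by decide +kernel)

theorem cubefreeMorphism_five :
    CubefreeMorphism fun a => (List.range 5).map (bitWord (if a then 13 else 18)) :=
  cubefreeMorphism_of_tripleImage (by decide) 6 (by decide) (by decide +kernel)
    (by decide +kernel)

theorem cubefreeMorphism_seven :
    CubefreeMorphism fun a => (List.range 7).map (bitWord (if a then 108 else 100)) :=
  cubefreeMorphism_of_tripleImage (by decide) 7 (by decide) (by decide +kernel)
    (by decide +kernel)

theorem cubefreeMorphism_thirteen :
    CubefreeMorphism fun a => (List.range 13).map (bitWord (if a then 2918 else 2854)) :=
  cubefreeMorphism_of_tripleImage (by decide) 8 (by decide) (by decide +kernel)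
    (by decide +kernel)

theorem CubefreeMorphism.comp {g h : Bool → List Bool} (hg : CubefreeMorphism g)
    (hh : CubefreeMorphism h) : CubefreeMorphism fun a => (h a).flatMap g := by
  intro w hw
  rw [← List.flatMap_assoc]
  exact hg _ (hh w hw)

theorem stmt7 (k : ℕ) (hk : 1 ≤ k) (hodd : Odd k) :
    ∃ h : Bool → List Bool,
      (h false).length = k ∧ (h true).length = k ∧ CubefreeMorphism h := by
  by_cases hsmall : k < 11 ∨ k = 13
  · obtain rfl | rfl | rfl | rfl | rfl | rfl :
        k = 1 ∨ k = 3 ∨ k = 5 ∨ k = 7 ∨ k = 9 ∨ k = 13 := by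
      obtain ⟨c, rfl⟩ := hodd
      omega
    · exact ⟨fun a => [a], rfl, rfl, fun w hw => by simpa using hw⟩
    · exact ⟨_, by simp, by simp, cubefreeMorphism_three⟩
    · exact ⟨_, by simp, by simp, cubefreeMorphism_five⟩
    · exact ⟨_, by simp, by simp, cubefreeMorphism_seven⟩
    · exact ⟨_, by decide, by decide, cubefreeMorphism_three.comp cubefreeMorphism_three⟩
    · exact ⟨_, by simp, by simp, cubefreeMorphism_thirteen⟩
  · obtain ⟨l, rfl⟩ : ∃ l, k = 2 * l + 3 := by
      obtain ⟨c, rfl⟩ := hodd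
      exact ⟨c - 1, by omega⟩
    obtain ⟨x, x', hx, hx', hne⟩ := exists_distinct_cores l (by omega) (by omega)
    refine ⟨_, by simp, by simp, cubefreeMorphism_markedBlock (l := l)
      (x := fun a => if a then x' else x) (by omega) (fun a => ?_) (by simpa using hne)⟩
    cases a
    · simpa using hx
    · simpa using hx'
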